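/- arXiv:1512.04702 — 2 statements merged into one kernel-verified Lean document; each statement's English description precedes it below -/
import Mathlib

section
/- Under the stated hypotheses, if in addition φ is μ-strongly convex for some μ > 0 and z denotes the unique element of S, then ∫_0^∞ ‖x(t) − z‖² dt < +∞. -/
open Filter MeasureTheory Set RealInnerProductSpace

/-- First-order inequality for a convex function having a gradient at `a`. -/
lemma ConvexOn.add_inner_gradient_le {E : Type*} [NormedAddCommGroup E] [InnerProductSpace ℝ E]
    [CompleteSpace E] {f : E → ℝ} {g a : E} (hf : ConvexOn ℝ univ f) (hg : HasGradientAt f g a)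
    (b : E) : f a + ⟪g, b - a⟫ ≤ f b := by
  have hc : ConvexOn ℝ univ (f ∘ AffineMap.lineMap (k := ℝ) a b) := by
    simpa using hf.comp_affineMap (AffineMap.lineMap (k := ℝ) a b)
  have hd : HasDerivAt (f ∘ AffineMap.lineMap (k := ℝ) a b) ⟪g, b - a⟫ 0 := by
    have h := (hasGradientAt_iff_hasFDerivAt.1 hg)
    rw [← AffineMap.lineMap_apply_zero (k := ℝ) a b] at h
    simpa using h.comp_hasDerivAt (0 : ℝ) AffineMap.hasDerivAt_lineMap
  have := hc.le_slope_of_hasDerivAt (mem_univ 0) (mem_univ 1) one_pos hd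
  simp [slope_def_field] at this
  linarith

/-- The gradient of a strongly convex function is strongly monotone. -/
lemma inner_gradient_sub_ge_of_strongConvex {E : Type*} [NormedAddCommGroup E]
    [InnerProductSpace ℝ E] [CompleteSpace E] {f : E → ℝ} {μ : ℝ} (hf : Differentiable ℝ f)
    (hconv : ConvexOn ℝ univ (fun y => f y - μ / 2 * ‖y‖ ^ 2)) (a b : E) :
    ⟪gradient f b, a - b⟫ + μ * ‖a - b‖ ^ 2 ≤ ⟪gradient f a, a - b⟫ := by
  have hg (u : E) :
      HasGradientAt (fun y => f y - μ / 2 * ‖y‖ ^ 2) (gradient f u - μ • u) u := by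
    rw [hasGradientAt_iff_hasFDerivAt]
    have h1 := hasGradientAt_iff_hasFDerivAt.1 (hf u).hasGradientAt
    have h2 := h1.sub ((hasStrictFDerivAt_norm_sq u).hasFDerivAt.const_mul (μ / 2))
    refine h2.congr_fderiv ?_
    ext v
    simp
    ring
  have h1 := hconv.add_inner_gradient_le (hg a) b
  have h2 := hconv.add_inner_gradient_le (hg b) a
  rw [← neg_sub a b] at h1
  have h3 : μ * ‖a - b‖ ^ 2 = μ * ⟪a, a - b⟫ - μ * ⟪b, a - b⟫ := by
    rw [← real_inner_self_eq_norm_sq, inner_sub_left (𝕜 := ℝ) a b]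
    ring
  simp only [inner_sub_left (𝕜 := ℝ) (gradient f _), inner_neg_right, real_inner_smul_left]
    at h1 h2
  linarith

/-- First-order optimality condition for minimizing `f` over a convex set. -/
lemma inner_gradient_nonneg_of_isMinOn {E : Type*} [NormedAddCommGroup E]
    [InnerProductSpace ℝ E] [CompleteSpace E] {f : E → ℝ} {C : Set E} {z y : E}
    (hC : Convex ℝ C) (hf : DifferentiableAt ℝ f z) (hmin : IsMinOn f C z) (hz : z ∈ C)
    (hy : y ∈ C) : 0 ≤ ⟪gradient f z, y - z⟫ := by
  have h1 := (hasGradientAt_iff_hasFDerivAt.1 hf.hasGradientAt).hasFDerivWithinAt (s := C)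
  have := hmin.localize.hasFDerivWithinAt_nonneg h1
    (sub_mem_posTangentConeAt_of_segment_subset (hC.segment_subset hz hy))
  simpa using this

lemma HasGradientAt.comp_hasDerivAt {E : Type*} [NormedAddCommGroup E]
    [InnerProductSpace ℝ E] [CompleteSpace E] {f : E → ℝ} {g : E} {u : ℝ → E} {u' : E} {t : ℝ}
    (hf : HasGradientAt f g (u t)) (hu : HasDerivAt u u' t) :
    HasDerivAt (fun s => f (u s)) ⟪g, u'⟫ t := by
  simpa [Function.comp_def] using (hasGradientAt_iff_hasFDerivAt.1 hf).comp_hasDerivAt t hu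

/-- If `W` is bounded below and `W' ≤ a * f⁺ - q` with `f⁺` integrable and `q` nonnegative,
then `q` is integrable. -/
lemma integrableOn_Ici_of_hasDerivAt_le {W W' f q : ℝ → ℝ} {a m : ℝ} (ha : 0 ≤ a)
    (hW : ContinuousOn W (Ici 0)) (hW' : ∀ t, 0 < t → HasDerivAt W (W' t) t)
    (hm : ∀ t, 0 ≤ t → m ≤ W t) (hf : ContinuousOn f (Ici 0)) (hq : ContinuousOn q (Ici 0))
    (hq0 : ∀ t, 0 ≤ q t) (hle : ∀ t, 0 < t → W' t ≤ a * f t - q t)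
    (hfin : ∫⁻ t in Ici (0 : ℝ), ENNReal.ofReal (f t) ≠ ⊤) :
    IntegrableOn q (Ici 0) := by
  have hfc : ContinuousOn (fun t => max (f t) 0) (Ici 0) := hf.sup continuousOn_const
  have hfi : IntegrableOn (fun t => max (f t) 0) (Ici 0) := by
    refine ⟨hfc.aestronglyMeasurable measurableSet_Ici, ?_⟩
    rw [hasFiniteIntegral_iff_ofReal (ae_of_all _ fun t => le_max_right (f t) 0)]
    simpa [ENNReal.ofReal_max] using lt_top_iff_ne_top.2 hfin
  rw [integrableOn_Ici_iff_integrableOn_Ioi]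
  have hsub (T : ℝ) : Icc 0 T ⊆ Ici 0 := fun t ht => ht.1
  have hqi (T : ℝ) : IntegrableOn q (Icc 0 T) :=
    (hq.mono (hsub T)).integrableOn_compact isCompact_Icc
  refine integrableOn_Ioi_of_intervalIntegral_norm_bounded
    (W 0 - m + a * ∫ t in Ici (0 : ℝ), max (f t) 0) 0 (b := id)
    (fun T => (hqi T).mono_set Ioc_subset_Icc_self) tendsto_id ?_
  filter_upwards [eventually_ge_atTop 0] with T hT
  have hfT : IntegrableOn (fun t => max (f t) 0) (Icc 0 T) := hfi.mono_set (hsub T)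
  have key := intervalIntegral.sub_le_integral_of_hasDeriv_right_of_le hT (hW.mono (hsub T))
    (fun t ht => (hW' t ht.1).hasDerivWithinAt) ((hfT.const_mul a).sub (hqi T))
    (fun t ht => (hle t ht.1).trans
      (sub_le_sub_right (mul_le_mul_of_nonneg_left (le_max_left (f t) 0) ha) _))
  have i1 : IntervalIntegrable (fun t => max (f t) 0) volume 0 T :=
    (intervalIntegrable_iff_integrableOn_Icc_of_le hT).2 hfT
  have i2 : IntervalIntegrable q volume 0 T :=
    (intervalIntegrable_iff_integrableOn_Icc_of_le hT).2 (hqi T)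
  simp only [Pi.sub_apply] at key
  rw [intervalIntegral.integral_sub (i1.const_mul a) i2,
    intervalIntegral.integral_const_mul] at key
  have hle' : ∫ t in (0 : ℝ)..T, max (f t) 0 ≤ ∫ t in Ici (0 : ℝ), max (f t) 0 := by
    rw [intervalIntegral.integral_of_le hT]
    exact setIntegral_mono_set hfi (ae_of_all _ fun t => le_max_right _ _)
      (Ioc_subset_Icc_self.trans (hsub T)).eventuallyLE
  have hmT := hm T hT
  have := mul_le_mul_of_nonneg_left hle' ha
  simp only [id, Real.norm_of_nonneg (hq0 _)]
  linarith

theorem stmt14 {H : Type*} [NormedAddCommGroup H] [InnerProductSpace ℝ H] [CompleteSpace H]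
    (φ ψ : H → ℝ) (γ k : ℝ) (β β' : ℝ → ℝ) (x x' x'' : ℝ → H)
    -- ψ is convex, Fréchet differentiable with Lipschitz continuous gradient,
    -- nonnegative, and argmin ψ = ψ⁻¹(0) is nonempty
    (hψconv : ConvexOn ℝ univ ψ)
    (hψdiff : Differentiable ℝ ψ)
    (hψlip : ∃ L : NNReal, LipschitzWith L (gradient ψ))
    (hψnonneg : ∀ y, 0 ≤ ψ y)
    (hψmin : ∃ y, ψ y = 0)
    -- φ is convex, Fréchet differentiable with Lipschitz continuous gradient,
    -- bounded from below, and S = {z ∈ argmin ψ : φ z ≤ φ y ∀ y ∈ argmin ψ} is nonempty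
    (hφconv : ConvexOn ℝ univ φ)
    (hφdiff : Differentiable ℝ φ)
    (hφlip : ∃ L : NNReal, LipschitzWith L (gradient φ))
    (hφbdd : BddBelow (range φ))
    (hS : ∃ z : H, ψ z = 0 ∧ ∀ y, ψ y = 0 → φ z ≤ φ y)
    -- γ > 0, 0 ≤ k < γ, and β : [0,∞) → (0,∞) is a C¹ function (with derivative β')
    -- satisfying the growth condition 0 ≤ β' ≤ k β
    (hγ : 0 < γ) (hk : 0 ≤ k) (hkγ : k < γ)
    (hβpos : ∀ t ∈ Ici (0 : ℝ), 0 < β t)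
    (hβderiv : ∀ t ∈ Ici (0 : ℝ), HasDerivWithinAt β (β' t) (Ici 0) t)
    (hβ'cont : ContinuousOn β' (Ici 0))
    (hβgrowth : ∀ t ∈ Ici (0 : ℝ), 0 ≤ β' t ∧ β' t ≤ k * β t)
    -- condition (H): for every p in the range of the normal cone to argmin ψ (i.e.
    -- p ∈ N(z) for some z ∈ argmin ψ = ψ⁻¹(0)), the integral
    -- ∫_0^∞ β(t) [ψ*(p/β(t)) - σ(p/β(t))] dt is finite; here σ(p/β(t)) = ⟪p/β(t), z⟫
    -- since p ∈ N(z), and β(t)[ψ*(q) - ⟪q, z⟫] = ⨆ w, β(t)((⟪q, w⟫ - ψ w) - ⟪q, z⟫) ≥ 0.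
    (hH : ∀ z p : H, ψ z = 0 → (∀ y, ψ y = 0 → ⟪p, y - z⟫ ≤ 0) →
      ∫⁻ t in Ici (0 : ℝ), ⨆ w : H,
        ENNReal.ofReal (β t * ((⟪(β t)⁻¹ • p, w⟫ - ψ w) - ⟪(β t)⁻¹ • p, z⟫)) ≠ ⊤)
    -- x : [0,∞) → H is twice continuously differentiable (first derivative x',
    -- second derivative x'') and satisfies ẍ + γ ẋ + ∇φ(x) + β ∇ψ(x) = 0 on [0,∞)
    (hx' : ∀ t ∈ Ici (0 : ℝ), HasDerivWithinAt x (x' t) (Ici 0) t)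
    (hx'' : ∀ t ∈ Ici (0 : ℝ), HasDerivWithinAt x' (x'' t) (Ici 0) t)
    (hx''cont : ContinuousOn x'' (Ici 0))
    (hode : ∀ t ∈ Ici (0 : ℝ),
      x'' t + γ • x' t + gradient φ (x t) + β t • gradient ψ (x t) = 0)
    -- φ is μ-strongly convex for some μ > 0, and z is the unique element of S
    (μ : ℝ) (hμ : 0 < μ)
    (hstrong : ConvexOn ℝ univ (fun y => φ y - μ / 2 * ‖y‖ ^ 2))
    (z : H) (hz : ψ z = 0 ∧ ∀ y, ψ y = 0 → φ z ≤ φ y)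
    (hzuniq : ∀ w : H, (ψ w = 0 ∧ ∀ y, ψ y = 0 → φ w ≤ φ y) → w = z) :
    IntegrableOn (fun t => ‖x t - z‖ ^ 2) (Ici 0) := by
  obtain ⟨hψz, hφz⟩ := hz
  obtain ⟨m, hm⟩ := hφbdd
  -- the weight of the anchor term in the Lyapunov function `W`
  obtain ⟨c, hkc, hcγ⟩ := exists_between hkγ
  have hc : 0 < c := hk.trans_lt hkc
  have hck : 0 < c - k := sub_pos.2 hkc
  have hC : Convex ℝ {y | ψ y = 0} := by
    have h : {y | ψ y = 0} = {y ∈ univ | ψ y ≤ 0} := by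
      ext y
      simp [(hψnonneg y).ge_iff_eq']
    rw [h]
    exact hψconv.convex_le 0
  set p : H := (-(c / (c - k))) • gradient φ z with hp
  have hpN : ∀ y, ψ y = 0 → ⟪p, y - z⟫ ≤ 0 := by
    intro y hy
    have h := inner_gradient_nonneg_of_isMinOn hC (hφdiff z) (fun y hy => hφz y hy) hψz hy
    rw [hp, real_inner_smul_left, neg_mul]
    exact neg_nonpos.2 (mul_nonneg (div_pos hc hck).le h)
  have hxc : ContinuousOn x (Ici 0) := fun t ht => (hx' t ht).continuousWithinAt
  have hx'c : ContinuousOn x' (Ici 0) := fun t ht => (hx'' t ht).continuousWithinAt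
  have hβc : ContinuousOn β (Ici 0) := fun t ht => (hβderiv t ht).continuousWithinAt
  have hψx : ContinuousOn (fun t => ψ (x t)) (Ici 0) := hψdiff.continuous.comp_continuousOn hxc
  have hφx : ContinuousOn (fun t => φ (x t)) (Ici 0) := hφdiff.continuous.comp_continuousOn hxc
  have hxz : ContinuousOn (fun t => x t - z) (Ici 0) := hxc.sub continuousOn_const
  set f : ℝ → ℝ := fun t => ⟪p, x t - z⟫ - β t * ψ (x t) with hf
  have hfc : ContinuousOn f (Ici 0) :=
    (continuousOn_const.inner hxz).sub (hβc.mul hψx)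
  have hfin : ∫⁻ t in Ici (0 : ℝ), ENNReal.ofReal (f t) ≠ ⊤ := by
    refine ne_top_of_le_ne_top (hH z p hψz hpN) (setLIntegral_mono' measurableSet_Ici ?_)
    intro t ht
    refine le_iSup_of_le (x t) (le_of_eq ?_)
    have := (hβpos t ht).ne'
    simp only [hf, real_inner_smul_left, inner_sub_right]
    congr 1
    field_simp
    ring
  set W : ℝ → ℝ := fun t => 1 / 2 * ‖x' t‖ ^ 2 + φ (x t) + β t * ψ (x t) +
    c * (⟪x' t, x t - z⟫ + γ / 2 * ‖x t - z‖ ^ 2) with hW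
  have hWc : ContinuousOn W (Ici 0) :=
    ((((hx'c.norm.pow 2).const_mul (1 / 2)).add hφx).add (hβc.mul hψx)).add
      (((hx'c.inner hxz).add ((hxz.norm.pow 2).const_mul (γ / 2))).const_mul c)
  have hq : IntegrableOn (fun t => c * μ * ‖x t - z‖ ^ 2) (Ici 0) := by
    refine integrableOn_Ici_of_hasDerivAt_le (W := W) (f := f) (m := m) hck.le hWc
      (W' := fun t => 1 / 2 * (2 * ⟪x' t, x'' t⟫) + ⟪gradient φ (x t), x' t⟫ +
        (β' t * ψ (x t) + β t * ⟪gradient ψ (x t), x' t⟫) +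
        c * ((⟪x' t, x' t⟫ + ⟪x'' t, x t - z⟫) + γ / 2 * (2 * ⟪x t - z, x' t⟫)))
      ?_ ?_ hfc (by fun_prop) (fun t => by positivity) ?_ hfin
    · intro t ht
      have hn : Ici (0 : ℝ) ∈ nhds t := Ici_mem_nhds ht
      have d1 := (hx' t ht.le).hasDerivAt hn
      have d2 := (hx'' t ht.le).hasDerivAt hn
      have d3 := (hβderiv t ht.le).hasDerivAt hn
      have d4 := d1.sub_const z
      exact (((d2.norm_sq.const_mul (1 / 2)).add
        ((hφdiff (x t)).hasGradientAt.comp_hasDerivAt d1)).add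
        (d3.mul ((hψdiff (x t)).hasGradientAt.comp_hasDerivAt d1))).add
        (((d2.inner ℝ d4).add (d4.norm_sq.const_mul (γ / 2))).const_mul c)
    · intro t ht
      have h1 : m ≤ φ (x t) := hm (mem_range_self _)
      have h2 := mul_nonneg (hβpos t ht).le (hψnonneg (x t))
      have h3 : 0 ≤ ‖x' t + c • (x t - z)‖ ^ 2 := by positivity
      rw [norm_add_sq_real, real_inner_smul_right, norm_smul, mul_pow, Real.norm_eq_abs,
        sq_abs] at h3
      have h4 : 0 ≤ c * (γ - c) * ‖x t - z‖ ^ 2 :=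
        mul_nonneg (mul_nonneg hc.le (sub_nonneg.2 hcγ.le)) (by positivity)
      simp only [hW]
      linarith
    · intro t ht
      have e : x'' t = -(γ • x' t) - gradient φ (x t) - β t • gradient ψ (x t) := by
        rw [← sub_eq_zero, ← hode t ht.le]
        abel
      have hβψ : β' t * ψ (x t) ≤ k * β t * ψ (x t) :=
        mul_le_mul_of_nonneg_right (hβgrowth t ht.le).2 (hψnonneg _)
      have hs := mul_le_mul_of_nonneg_left
        (inner_gradient_sub_ge_of_strongConvex hφdiff hstrong (x t) z) hc.le
      have hψg : ψ (x t) ≤ ⟪gradient ψ (x t), x t - z⟫ := by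
        have := hψconv.add_inner_gradient_le (hψdiff (x t)).hasGradientAt z
        rw [← neg_sub, inner_neg_right, hψz] at this
        linarith
      have hψg' := mul_le_mul_of_nonneg_left hψg (mul_nonneg hc.le (hβpos t ht.le).le)
      have hγc : 0 ≤ (γ - c) * ‖x' t‖ ^ 2 :=
        mul_nonneg (sub_nonneg.2 hcγ.le) (by positivity)
      have hpf : (c - k) * f t =
          -(c * ⟪gradient φ z, x t - z⟫) - (c - k) * (β t * ψ (x t)) := by
        simp only [hf, hp, real_inner_smul_left]
        field_simp
      simp only [hpf, e, inner_sub_left (𝕜 := ℝ) (_ - _) _ (x t - z),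
        inner_sub_left (𝕜 := ℝ) (-_) _ (x t - z), inner_sub_right (𝕜 := ℝ) (x' t),
        inner_neg_left, inner_neg_right, real_inner_smul_left, real_inner_smul_right,
        real_inner_self_eq_norm_sq, real_inner_comm (x' t)]
      linarith
  have hcμ : c * μ ≠ 0 := (mul_pos hc hμ).ne'
  simpa only [IntegrableOn, inv_mul_cancel_left₀ hcμ] using hq.const_mul (c * μ)⁻¹
end

section
/- Under the stated hypotheses, the energy functional E(t) = ½‖ẋ(t)‖² + φ(x(t)) + β(t) ψ(x(t)) has a finite limit as t → +∞. -/
open Filter MeasureTheory Set RealInnerProductSpace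

/-- First-order lower bound for a differentiable convex function. -/
theorem ConvexOn.add_inner_gradient_le_s15 {H : Type*} [NormedAddCommGroup H]
    [InnerProductSpace ℝ H] [CompleteSpace H] {f : H → ℝ} (hf : ConvexOn ℝ univ f)
    (hd : Differentiable ℝ f) (u v : H) : f u + ⟪gradient f u, v - u⟫ ≤ f v := by
  have hline : HasDerivAt (fun s : ℝ => AffineMap.lineMap (k := ℝ) u v s) (v - u) 0 :=
    AffineMap.hasDerivAt_lineMap
  have hcomp : HasDerivAt (fun s : ℝ => f (AffineMap.lineMap u v s)) ⟪gradient f u, v - u⟫ 0 := by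
    have hgrad : HasFDerivAt f (InnerProductSpace.toDual ℝ H (gradient f u))
        (AffineMap.lineMap u v (0 : ℝ)) := by
      rw [AffineMap.lineMap_apply_zero]
      exact (hd u).hasGradientAt.hasFDerivAt
    exact hgrad.comp_hasDerivAt (0 : ℝ) hline
  have hconv : ConvexOn ℝ univ (fun s : ℝ => f (AffineMap.lineMap u v s)) :=
    hf.comp_affineMap (AffineMap.lineMap u v)
  have hslope := hconv.le_slope_of_hasDerivAt (mem_univ 0) (mem_univ 1) one_pos hcomp
  simp only [slope_def_field, AffineMap.lineMap_apply_one, AffineMap.lineMap_apply_zero, sub_zero,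
    div_one] at hslope
  linarith

/-- The gradient of a differentiable convex function is a monotone operator. -/
theorem ConvexOn.inner_gradient_le_inner_gradient {H : Type*} [NormedAddCommGroup H]
    [InnerProductSpace ℝ H] [CompleteSpace H] {f : H → ℝ} (hf : ConvexOn ℝ univ f)
    (hd : Differentiable ℝ f) (u v : H) :
    ⟪gradient f v, u - v⟫ ≤ ⟪gradient f u, u - v⟫ := by
  have huv := hf.add_inner_gradient_le_s15 hd u v
  have hvu := hf.add_inner_gradient_le_s15 hd v u
  rw [← neg_sub u v, inner_neg_right] at huv
  linarith

/-- Variational inequality characterizing a minimizer on a convex set. -/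
theorem IsMinOn.inner_gradient_sub_nonneg {H : Type*} [NormedAddCommGroup H]
    [InnerProductSpace ℝ H] [CompleteSpace H] {f : H → ℝ} {s : Set H} {z y : H}
    (hmin : IsMinOn f s z) (hs : Convex ℝ s) (hd : DifferentiableAt ℝ f z)
    (hz : z ∈ s) (hy : y ∈ s) : 0 ≤ ⟪gradient f z, y - z⟫ :=
  hmin.localize.hasFDerivWithinAt_nonneg hd.hasGradientAt.hasFDerivAt.hasFDerivWithinAt
    (sub_mem_posTangentConeAt_of_segment_subset (hs.segment_subset hz hy))

/-- Chain rule for a differentiable function along a curve, in terms of the gradient. -/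
theorem HasDerivWithinAt.comp_gradient {H : Type*} [NormedAddCommGroup H]
    [InnerProductSpace ℝ H] [CompleteSpace H] {f : H → ℝ} {x : ℝ → H} {v : H} {s : Set ℝ}
    {t : ℝ} (hx : HasDerivWithinAt x v s t) (hd : DifferentiableAt ℝ f (x t)) :
    HasDerivWithinAt (fun τ => f (x τ)) ⟪gradient f (x t), v⟫ s t :=
  hd.hasGradientAt.hasFDerivAt.comp_hasDerivWithinAt t hx

/-- A nonnegative dissipation rate `W` is integrable on `[0, ∞)` as soon as it is dominated by the
decay of a function bounded from below, up to an integrable error. -/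
theorem integrableOn_Ioi_of_hasDerivWithinAt_le_sub {V V' W g : ℝ → ℝ} {m : ℝ}
    (hV : ∀ t ∈ Ici (0 : ℝ), HasDerivWithinAt V (V' t) (Ici 0) t)
    (hV' : ContinuousOn V' (Ici 0)) (hm : ∀ t ∈ Ici (0 : ℝ), m ≤ V t)
    (hW : ContinuousOn W (Ici 0)) (hW0 : ∀ t ∈ Ici (0 : ℝ), 0 ≤ W t)
    (hg : IntegrableOn g (Ioi 0)) (hg0 : ∀ t ∈ Ici (0 : ℝ), 0 ≤ g t)
    (hle : ∀ t ∈ Ici (0 : ℝ), V' t ≤ g t - W t) : IntegrableOn W (Ioi 0) := by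
  refine integrableOn_Ioi_of_intervalIntegral_norm_bounded
    (V 0 - m + ∫ t in Ioi (0 : ℝ), g t) 0 (b := fun T : ℝ => T) (l := atTop) (fun T => ?_)
    tendsto_id ?_
  · exact ((hW.mono Icc_subset_Ici_self).integrableOn_Icc).mono_set Ioc_subset_Icc_self
  filter_upwards [eventually_ge_atTop 0] with T hT
  have hsub : Icc 0 T ⊆ Ici (0 : ℝ) := Icc_subset_Ici_self
  have hV'int : IntervalIntegrable V' volume 0 T :=
    (hV'.mono hsub).intervalIntegrable_of_Icc hT
  have hWint : IntervalIntegrable W volume 0 T := (hW.mono hsub).intervalIntegrable_of_Icc hT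
  have hgint : IntervalIntegrable g volume 0 T :=
    (intervalIntegrable_iff_integrableOn_Ioc_of_le hT).2 (hg.mono_set Ioc_subset_Ioi_self)
  have hftc : ∫ t in (0 : ℝ)..T, V' t = V T - V 0 :=
    intervalIntegral.integral_eq_sub_of_hasDerivAt_of_le hT
      (fun t ht => (hV t (hsub ht)).continuousWithinAt.mono hsub)
      (fun t ht => (hV t ht.1.le).hasDerivAt (Ici_mem_nhds ht.1)) hV'int
  have hnorm : ∫ t in (0 : ℝ)..T, ‖W t‖ = ∫ t in (0 : ℝ)..T, W t := by
    refine intervalIntegral.integral_congr fun t ht => ?_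
    rw [uIcc_of_le hT] at ht
    exact Real.norm_of_nonneg (hW0 t ht.1)
  have hmono : ∫ t in (0 : ℝ)..T, W t ≤ ∫ t in (0 : ℝ)..T, (g t - V' t) :=
    intervalIntegral.integral_mono_on hT hWint (hgint.sub hV'int)
      fun t ht => by linarith [hle t ht.1]
  have hgle : ∫ t in (0 : ℝ)..T, g t ≤ ∫ t in Ioi (0 : ℝ), g t := by
    rw [intervalIntegral.integral_of_le hT]
    exact setIntegral_mono_set hg
      ((ae_restrict_iff' measurableSet_Ioi).2 (.of_forall fun t ht => hg0 t (mem_Ioi.1 ht).le))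
      Ioc_subset_Ioi_self.eventuallyLE
  rw [intervalIntegral.integral_sub hgint hV'int, hftc] at hmono
  rw [hnorm]
  linarith [hm T hT]

theorem stmt15 {H : Type*} [NormedAddCommGroup H] [InnerProductSpace ℝ H] [CompleteSpace H]
    (φ ψ : H → ℝ) (γ k : ℝ) (β β' : ℝ → ℝ) (x x' x'' : ℝ → H)
    -- ψ is convex, Fréchet differentiable with Lipschitz continuous gradient,
    -- nonnegative, and argmin ψ = ψ⁻¹(0) is nonempty
    (hψconv : ConvexOn ℝ univ ψ)
    (hψdiff : Differentiable ℝ ψ)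
    (hψlip : ∃ L : NNReal, LipschitzWith L (gradient ψ))
    (hψnonneg : ∀ y, 0 ≤ ψ y)
    (hψmin : ∃ y, ψ y = 0)
    -- φ is convex, Fréchet differentiable with Lipschitz continuous gradient,
    -- bounded from below, and S = {z ∈ argmin ψ : φ z ≤ φ y ∀ y ∈ argmin ψ} is nonempty
    (hφconv : ConvexOn ℝ univ φ)
    (hφdiff : Differentiable ℝ φ)
    (hφlip : ∃ L : NNReal, LipschitzWith L (gradient φ))
    (hφbdd : BddBelow (range φ))
    (hS : ∃ z : H, ψ z = 0 ∧ ∀ y, ψ y = 0 → φ z ≤ φ y)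
    -- γ > 0, 0 ≤ k < γ, and β : [0,∞) → (0,∞) is a C¹ function (with derivative β')
    -- satisfying the growth condition 0 ≤ β' ≤ k β
    (hγ : 0 < γ) (hk : 0 ≤ k) (hkγ : k < γ)
    (hβpos : ∀ t ∈ Ici (0 : ℝ), 0 < β t)
    (hβderiv : ∀ t ∈ Ici (0 : ℝ), HasDerivWithinAt β (β' t) (Ici 0) t)
    (hβ'cont : ContinuousOn β' (Ici 0))
    (hβgrowth : ∀ t ∈ Ici (0 : ℝ), 0 ≤ β' t ∧ β' t ≤ k * β t)
    -- condition (H): for every p in the range of the normal cone to argmin ψ (i.e.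
    -- p ∈ N(z) for some z ∈ argmin ψ = ψ⁻¹(0)), the integral
    -- ∫_0^∞ β(t) [ψ*(p/β(t)) - σ(p/β(t))] dt is finite; here σ(p/β(t)) = ⟪p/β(t), z⟫
    -- since p ∈ N(z), and β(t)[ψ*(q) - ⟪q, z⟫] = ⨆ w, β(t)((⟪q, w⟫ - ψ w) - ⟪q, z⟫) ≥ 0.
    (hH : ∀ z p : H, ψ z = 0 → (∀ y, ψ y = 0 → ⟪p, y - z⟫ ≤ 0) →
      ∫⁻ t in Ici (0 : ℝ), ⨆ w : H,
        ENNReal.ofReal (β t * ((⟪(β t)⁻¹ • p, w⟫ - ψ w) - ⟪(β t)⁻¹ • p, z⟫)) ≠ ⊤)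
    -- x : [0,∞) → H is twice continuously differentiable (first derivative x',
    -- second derivative x'') and satisfies ẍ + γ ẋ + ∇φ(x) + β ∇ψ(x) = 0 on [0,∞)
    (hx' : ∀ t ∈ Ici (0 : ℝ), HasDerivWithinAt x (x' t) (Ici 0) t)
    (hx'' : ∀ t ∈ Ici (0 : ℝ), HasDerivWithinAt x' (x'' t) (Ici 0) t)
    (hx''cont : ContinuousOn x'' (Ici 0))
    (hode : ∀ t ∈ Ici (0 : ℝ),
      x'' t + γ • x' t + gradient φ (x t) + β t • gradient ψ (x t) = 0) :
    ∃ L : ℝ, Tendsto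
      (fun t => 1 / 2 * ‖x' t‖ ^ 2 + φ (x t) + β t * ψ (x t)) atTop (nhds L) := by
  obtain ⟨z, hz, hzmin⟩ := hS
  obtain ⟨m, hm⟩ := hφbdd
  replace hm : ∀ y, m ≤ φ y := fun y => hm (mem_range_self y)
  have hxc : ContinuousOn x (Ici 0) := fun t ht => (hx' t ht).continuousWithinAt
  have hx'c : ContinuousOn x' (Ici 0) := fun t ht => (hx'' t ht).continuousWithinAt
  have hβc : ContinuousOn β (Ici 0) := fun t ht => (hβderiv t ht).continuousWithinAt
  have hψc : ContinuousOn (fun t => ψ (x t)) (Ici 0) := hψdiff.continuous.comp_continuousOn hxc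
  have hβψ : ∀ t ∈ Ici (0 : ℝ), 0 ≤ β t * ψ (x t) := fun t ht =>
    mul_nonneg (hβpos t ht).le (hψnonneg _)
  have hconvmin : Convex ℝ {y | ψ y = 0} := by
    have heq : {y | ψ y = 0} = {y ∈ univ | ψ y ≤ 0} := by
      ext y
      simp [le_antisymm_iff, hψnonneg y]
    rw [heq]
    exact hψconv.convex_le 0
  have hvar : ∀ y, ψ y = 0 → 0 ≤ ⟪gradient φ z, y - z⟫ := fun y hy =>
    IsMinOn.inner_gradient_sub_nonneg (s := {y | ψ y = 0}) (fun w hw => hzmin w hw) hconvmin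
      (hφdiff z) hz hy
  obtain ⟨d, hd⟩ : ∃ d, d = (γ - k) / 4 := ⟨_, rfl⟩
  obtain ⟨a, ha⟩ : ∃ a, a = (γ + k) / 2 := ⟨_, rfl⟩
  have hd0 : 0 < d := by rw [hd]; linarith
  have ha0 : 0 < a := by rw [ha]; linarith
  have haγ : a < γ := by rw [ha]; linarith
  obtain ⟨q, hq⟩ : ∃ q, q = -(a / d) • gradient φ z := ⟨_, rfl⟩
  -- The error term controlled by condition (H).
  set g : ℝ → ℝ := fun t => max (⟪q, x t - z⟫ - β t * ψ (x t)) 0 with hg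
  have hgint : IntegrableOn g (Ioi 0) := by
    have hgc : ContinuousOn g (Ici 0) :=
      ((continuousOn_const.inner (hxc.sub continuousOn_const)).sub (hβc.mul hψc)).sup
        continuousOn_const
    have hgm := (hgc.mono Ioi_subset_Ici_self).aestronglyMeasurable (μ := volume) measurableSet_Ioi
    refine ⟨hgm, (hasFiniteIntegral_iff_ofReal (.of_forall fun t => le_max_right _ _)).2 ?_⟩
    refine lt_of_le_of_lt ?_ (hH z q hz fun y hy => ?_).lt_top
    · refine (lintegral_mono_set Ioi_subset_Ici_self).trans
        (setLIntegral_mono' measurableSet_Ici fun t ht => ?_)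
      refine le_trans (le_of_eq ?_) (le_iSup _ (x t))
      have hβ := (hβpos t ht).ne'
      change ENNReal.ofReal (max (⟪q, x t - z⟫ - β t * ψ (x t)) (0 : ℝ)) = _
      rw [ENNReal.ofReal_max, ENNReal.ofReal_zero, max_eq_left zero_le]
      congr 1
      rw [real_inner_smul_left, real_inner_smul_left, inner_sub_right]
      field_simp
      ring
    · rw [hq, real_inner_smul_left]
      exact mul_nonpos_of_nonpos_of_nonneg (neg_nonpos.2 (div_pos ha0 hd0).le) (hvar y hy)
  set E : ℝ → ℝ := fun t => 1 / 2 * ‖x' t‖ ^ 2 + φ (x t) + β t * ψ (x t) with hE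
  set E' : ℝ → ℝ := fun t => -γ * ‖x' t‖ ^ 2 + β' t * ψ (x t) with hE'
  have hEderiv : ∀ t ∈ Ici (0 : ℝ), HasDerivWithinAt E (E' t) (Ici 0) t := fun t ht => by
    have h := (((hx'' t ht).norm_sq.const_mul (1 / 2)).add
      ((hx' t ht).comp_gradient (hφdiff _))).add
        ((hβderiv t ht).mul ((hx' t ht).comp_gradient (hψdiff _)))
    refine h.congr_deriv ?_
    have hinner := congrArg (fun v => ⟪v, x' t⟫) (hode t ht)
    simp only [inner_add_left, real_inner_smul_left, inner_zero_left,
      real_inner_self_eq_norm_sq] at hinner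
    rw [real_inner_comm (x'' t) (x' t), hE']
    linarith
  have hE'c : ContinuousOn E' (Ici 0) :=
    (continuousOn_const.mul (hx'c.norm.pow 2)).add (hβ'cont.mul hψc)
  have hVderiv : ∀ t ∈ Ici (0 : ℝ), HasDerivWithinAt
      (fun t => E t + a * ⟪x' t, x t - z⟫ + a * γ / 2 * ‖x t - z‖ ^ 2)
      (E' t + a * (⟪x' t, x' t⟫ + ⟪x'' t, x t - z⟫) + a * γ / 2 * (2 * ⟪x t - z, x' t⟫))
      (Ici 0) t := fun t ht => by
    have hxz := (hx' t ht).sub_const z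
    exact ((hEderiv t ht).add (((hx'' t ht).inner ℝ hxz).const_mul a)).add
      (hxz.norm_sq.const_mul (a * γ / 2))
  have hW : IntegrableOn (fun t => d * (‖x' t‖ ^ 2 + β t * ψ (x t))) (Ioi 0) := by
    refine integrableOn_Ioi_of_hasDerivWithinAt_le_sub (m := m) (g := fun t => d * g t) hVderiv
      (by fun_prop) (fun t ht => ?_)
      (continuousOn_const.mul ((hx'c.norm.pow 2).add (hβc.mul hψc))) (fun t ht => ?_)
      (hgint.const_mul d) (fun t ht => mul_nonneg hd0.le (le_max_right _ _)) (fun t ht => ?_)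
    · have hsq := norm_add_sq_real (x' t) (a • (x t - z))
      rw [real_inner_smul_right, norm_smul, Real.norm_of_nonneg ha0.le] at hsq
      have hrest : 0 ≤ a * (γ - a) * ‖x t - z‖ ^ 2 :=
        mul_nonneg (mul_nonneg ha0.le (sub_nonneg.2 haγ.le)) (sq_nonneg _)
      have := hβψ t ht
      have := hm (x t)
      simp only [hE]
      nlinarith [sq_nonneg ‖x' t + a • (x t - z)‖]
    · exact mul_nonneg hd0.le (add_nonneg (sq_nonneg _) (hβψ t ht))
    · have hmonoφ := hφconv.inner_gradient_le_inner_gradient hφdiff (x t) z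
      have hψle := hψconv.add_inner_gradient_le_s15 hψdiff (x t) z
      rw [hz, ← neg_sub (x t) z, inner_neg_right] at hψle
      have hβψle : β t * ψ (x t) ≤ β t * ⟪gradient ψ (x t), x t - z⟫ :=
        mul_le_mul_of_nonneg_left (by linarith) (hβpos t ht).le
      have hinner := congrArg (fun v => ⟪v, x t - z⟫) (hode t ht)
      simp only [inner_add_left, real_inner_smul_left, inner_zero_left] at hinner
      have hβ'ψ : β' t * ψ (x t) ≤ k * β t * ψ (x t) :=
        mul_le_mul_of_nonneg_right (hβgrowth t ht).2 (hψnonneg _)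
      have hgle : d * (⟪q, x t - z⟫ - β t * ψ (x t)) ≤ d * g t :=
        mul_le_mul_of_nonneg_left (le_max_left _ _) hd0.le
      have hdq : d * ⟪q, x t - z⟫ = -a * ⟪gradient φ z, x t - z⟫ := by
        rw [hq, real_inner_smul_left]
        field_simp
      have hmul : a * (⟪x'' t, x t - z⟫ + γ * ⟪x' t, x t - z⟫) ≤
          a * (-⟪gradient φ z, x t - z⟫ - β t * ψ (x t)) :=
        mul_le_mul_of_nonneg_left (by linarith) ha0.le
      have had : a = k + 2 * d := by rw [ha, hd]; ring
      have hγd : γ = a + 2 * d := by rw [ha, hd]; ring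
      have hγsq : γ * ‖x' t‖ ^ 2 = a * ‖x' t‖ ^ 2 + 2 * (d * ‖x' t‖ ^ 2) := by
        conv_lhs => rw [hγd]
        ring
      have haβ : a * (β t * ψ (x t)) = k * β t * ψ (x t) + 2 * (d * (β t * ψ (x t))) := by
        conv_lhs => rw [had]
        ring
      have := mul_nonneg hd0.le (sq_nonneg ‖x' t‖)
      rw [real_inner_self_eq_norm_sq, real_inner_comm (x' t) (x t - z)]
      simp only [hE']
      linarith
  have hE'int : IntegrableOn E' (Ioi 0) := by
    refine (hW.const_mul ((γ + k) / d)).mono'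
      ((hE'c.mono Ioi_subset_Ici_self).aestronglyMeasurable measurableSet_Ioi)
      ((ae_restrict_iff' measurableSet_Ioi).2 (.of_forall fun t ht => ?_))
    have ht' : t ∈ Ici (0 : ℝ) := Ioi_subset_Ici_self ht
    have hβ'ψ : β' t * ψ (x t) ≤ k * β t * ψ (x t) :=
      mul_le_mul_of_nonneg_right (hβgrowth t ht').2 (hψnonneg _)
    have hβ'ψ0 : 0 ≤ β' t * ψ (x t) := mul_nonneg (hβgrowth t ht').1 (hψnonneg _)
    have hcancel : (γ + k) / d * (d * (‖x' t‖ ^ 2 + β t * ψ (x t))) =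
        (γ + k) * (‖x' t‖ ^ 2 + β t * ψ (x t)) := by
      field_simp
    have h1 := mul_nonneg hk (sq_nonneg ‖x' t‖)
    have h2 := mul_nonneg hγ.le (hβψ t ht')
    have h3 := mul_nonneg hγ.le (sq_nonneg ‖x' t‖)
    have h4 := mul_nonneg hk (hβψ t ht')
    rw [hcancel, Real.norm_eq_abs, abs_le]
    constructor <;> simp only [hE'] <;> linarith
  exact ⟨_, tendsto_limUnder_of_hasDerivAt_of_integrableOn_Ioi
    (fun t ht => (hEderiv t (Ioi_subset_Ici_self ht)).hasDerivAt (Ici_mem_nhds ht)) hE'int⟩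
end
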